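/- Suppose G is a marked graph with three unmarked vertices u, v, w such that u, v, w are pairwise adjacent, u is looped, v and w are unlooped, and every vertex x ∉ {u,v,w} is adjacent to either 0 or precisely 2 of u, v, w. Let G' be the marked graph obtained from G by removing the three edges {u,v}, {u,w} and {v,w} (all else unchanged). Then ⟨G⟩ = ⟨G'⟩. -/

import Mathlib

open MvPolynomial

/-- A marked graph: a finite vertex set, an adjacency matrix over GF(2)
(the diagonal entry at `v` is 1 iff `v` carries a loop; for `v ≠ w` the `(v,w)` entry
is 1 iff `v` and `w` are adjacent), a designated set of marked vertices, and a number
of free loops. -/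
structure MarkedGraph (V : Type) [Fintype V] [DecidableEq V] where
  adj : Matrix V V (ZMod 2)
  marked : V → Bool
  freeLoops : ℕ

namespace MarkedGraph

variable {V : Type} [Fintype V] [DecidableEq V]

/-- GF(2)-nullity of a square matrix: the dimension of its kernel. -/
noncomputable def nullity {ι : Type*} [Fintype ι] (M : Matrix ι ι (ZMod 2)) : ℕ :=
  Module.finrank (ZMod 2) (LinearMap.ker M.mulVecLin)

/-- The diagonal matrix `Δ_T` over GF(2) whose diagonal entry at `v` is 1 iff `v ∈ T`. -/
def delta (T : Finset V) : Matrix V V (ZMod 2) :=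
  Matrix.diagonal fun v => if v ∈ T then 1 else 0

/-- The vertices kept in the submatrix `𝒜(G)_T`: delete each marked vertex whose
diagonal entry in `𝒜(G) + Δ_T` is 0. -/
def keep (G : MarkedGraph V) (T : Finset V) : Finset V :=
  Finset.univ.filter fun v => ¬ (G.marked v = true ∧ (G.adj + delta T) v v = 0)

/-- The submatrix `𝒜(G)_T` of `𝒜(G) + Δ_T`. -/
def subMat (G : MarkedGraph V) (T : Finset V) :
    Matrix (G.keep T) (G.keep T) (ZMod 2) :=
  fun i j => (G.adj + delta T) i.1 j.1

/-- The marked-graph bracket polynomial `[G] ∈ ℤ[A,B,d]`, where `A = X 0`, `B = X 1`,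
`d = X 2`:  `[G] = d^φ ⬝ Σ_{T ⊆ V(G)} A^(n-|T|) B^(|T|) d^(ν(𝒜(G)_T))`. -/
noncomputable def bracket (G : MarkedGraph V) : MvPolynomial (Fin 3) ℤ :=
  X 2 ^ G.freeLoops *
    ∑ T : Finset V,
      X 0 ^ (Fintype.card V - T.card) * X 1 ^ T.card * X 2 ^ nullity (G.subMat T)

/-- `x` is a neighbor of `v` (no vertex is a neighbor of itself). -/
def nbr (G : MarkedGraph V) (v x : V) : Prop := x ≠ v ∧ G.adj v x = 1

instance (G : MarkedGraph V) (v x : V) : Decidable (G.nbr v x) :=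
  inferInstanceAs (Decidable (x ≠ v ∧ G.adj v x = 1))

/-- Delete the vertices in `s`, together with all incident edges
(marks and free loops unchanged). -/
def delete (G : MarkedGraph V) (s : Finset V) : MarkedGraph {v : V // v ∉ s} where
  adj := fun i j => G.adj i.1 j.1
  marked := fun i => G.marked i.1
  freeLoops := G.freeLoops

/-- The local complement `G^v`: toggle every entry of the adjacency matrix (diagonal
entries included) whose row and column indices are both neighbors of `v`. -/
def localComp (G : MarkedGraph V) (v : V) : MarkedGraph V :=
  { G with adj := fun x y => if G.nbr v x ∧ G.nbr v y then G.adj x y + 1 else G.adj x y }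

/-- `G - {v,v}`: remove the loop at `v` (set the diagonal entry at `v` to 0). -/
def removeLoop (G : MarkedGraph V) (v : V) : MarkedGraph V :=
  { G with adj := fun x y => if x = v ∧ y = v then 0 else G.adj x y }

/-- `G + I`: toggle all loops. -/
def addI (G : MarkedGraph V) : MarkedGraph V :=
  { G with adj := G.adj + 1 }

/-- `G⁺`: adjoin one free loop. -/
def addFreeLoop (G : MarkedGraph V) : MarkedGraph V :=
  { G with freeLoops := G.freeLoops + 1 }

/-- The condition under which the pivot `G^{vw}` toggles the adjacency between `x`
and `y`: `x` is a neighbor of `v`, `y` is a neighbor of `w`, and either `x` is not a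
neighbor of `w` or `y` is not a neighbor of `v`. -/
def pivotCond (G : MarkedGraph V) (v w x y : V) : Prop :=
  G.nbr v x ∧ G.nbr w y ∧ (¬ G.nbr w x ∨ ¬ G.nbr v y)

instance (G : MarkedGraph V) (v w x y : V) : Decidable (G.pivotCond v w x y) :=
  inferInstanceAs (Decidable (G.nbr v x ∧ G.nbr w y ∧ (¬ G.nbr w x ∨ ¬ G.nbr v y)))

/-- The pivot `G^{vw}`: toggle the adjacency between every pair of distinct vertices
`x, y ∉ {v,w}` such that `x` is a neighbor of `v`, `y` is a neighbor of `w`, and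
either `x` is not a neighbor of `w` or `y` is not a neighbor of `v`
(loops are unaffected). -/
def pivot (G : MarkedGraph V) (v w : V) : MarkedGraph V :=
  { G with adj := fun x y =>
      if x ≠ v ∧ x ≠ w ∧ y ≠ v ∧ y ≠ w ∧ x ≠ y ∧
          (G.pivotCond v w x y ∨ G.pivotCond v w y x)
      then G.adj x y + 1 else G.adj x y }

/-- Interchange the neighbors of `v` and `w` in an adjacency matrix, keeping loops
and the edge between `v` and `w` unchanged. -/
def swapAdjacencies (M : Matrix V V (ZMod 2)) (v w : V) : Matrix V V (ZMod 2) :=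
  fun x y =>
    if x = y then M x y
    else if (x = v ∧ y = w) ∨ (x = w ∧ y = v) then M x y
    else M (Equiv.swap v w x) (Equiv.swap v w y)

/-- The marked pivot `G_c^{vw}`: the pivot `G^{vw}` with the marks on `v` and `w`
toggled and the neighbors of `v` and `w` interchanged (loops, the edge between `v`
and `w`, and free loops unchanged). -/
def markedPivot (G : MarkedGraph V) (v w : V) : MarkedGraph V where
  adj := swapAdjacencies (G.pivot v w).adj v w
  marked := fun u => if u = v ∨ u = w then !(G.marked u) else G.marked u
  freeLoops := G.freeLoops

/-- The disjoint union of two marked graphs: block-diagonal adjacency matrix,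
each vertex marked as it was, free loops added. -/
def disjUnion {V₁ V₂ : Type} [Fintype V₁] [DecidableEq V₁] [Fintype V₂] [DecidableEq V₂]
    (G₁ : MarkedGraph V₁) (G₂ : MarkedGraph V₂) : MarkedGraph (V₁ ⊕ V₂) where
  adj := Matrix.fromBlocks G₁.adj 0 0 G₂.adj
  marked := Sum.elim G₁.marked G₂.marked
  freeLoops := G₁.freeLoops + G₂.freeLoops

/-- Remove the three edges `{u,v}`, `{u,w}`, `{v,w}` (all else unchanged). -/
def removeEdges3 (G : MarkedGraph V) (u v w : V) : MarkedGraph V :=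
  { G with adj := fun x y =>
      if (x = u ∧ y = v) ∨ (x = v ∧ y = u) ∨ (x = u ∧ y = w) ∨ (x = w ∧ y = u) ∨
          (x = v ∧ y = w) ∨ (x = w ∧ y = v)
      then 0 else G.adj x y }

/-- Adjoin one isolated, unmarked vertex with no incident edges; it is looped iff
`loop = true`. -/
def addIsolated (G : MarkedGraph V) (loop : Bool) : MarkedGraph (Option V) where
  adj := fun x y =>
    match x, y with
    | some a, some b => G.adj a b
    | none, none => if loop then 1 else 0
    | _, _ => 0
  marked := fun x => match x with | some a => G.marked a | none => false
  freeLoops := G.freeLoops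

/-- The number of vertices of `s` that are adjacent to `x`. -/
def countAdj (G : MarkedGraph V) (x : V) (s : Finset V) : ℕ :=
  (s.filter fun y => G.adj x y = 1).card

/-- The reduced marked-graph bracket `⟨G⟩ ∈ ℤ[A, A⁻¹]`: substitute `B ↦ A⁻¹` and
`d ↦ -A² - A⁻²` in `[G]`. -/
noncomputable def reducedBracket (G : MarkedGraph V) : LaurentPolynomial ℤ :=
  MvPolynomial.aeval
    ![LaurentPolynomial.T 1, LaurentPolynomial.T (-1),
      -LaurentPolynomial.T 2 - LaurentPolynomial.T (-2)] G.bracket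

/-- The number of looped vertices of `G`. -/
def numLoops (G : MarkedGraph V) : ℕ :=
  (Finset.univ.filter fun v => G.adj v v = 1).card

/-- The Jones polynomial `V_G = (-1)^n ⬝ q^(3n-6ℓ) ⬝ ⟨G⟩(q⁻¹)`, as a Laurent
polynomial in the formal variable `q` (representing `t^(1/4)`); substituting
`A ↦ q⁻¹` in `⟨G⟩` amounts to substituting `A ↦ q⁻¹`, `B ↦ q`, `d ↦ -q² - q⁻²`
in `[G]`. -/
noncomputable def jones (G : MarkedGraph V) : LaurentPolynomial ℤ :=
  (-1) ^ Fintype.card V *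
    LaurentPolynomial.T (3 * (Fintype.card V : ℤ) - 6 * (G.numLoops : ℤ)) *
    MvPolynomial.aeval
      ![LaurentPolynomial.T (-1), LaurentPolynomial.T 1,
        -LaurentPolynomial.T 2 - LaurentPolynomial.T (-2)] G.bracket

end MarkedGraph
namespace MarkedGraph

section Abstract

variable {E : Type} [AddCommGroup E] [Module (ZMod 2) E]

/-- The three equations at the vertices `u, v, w`. -/
def Eqs (p q r ε a b c s t : ZMod 2) : Prop :=
  p * a + ε * (b + c) + s = 0 ∧ q * b + ε * (a + c) + t = 0 ∧
    r * c + ε * (a + b) + (s + t) = 0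

instance (p q r ε a b c s t : ZMod 2) : Decidable (Eqs p q r ε a b c s t) :=
  inferInstanceAs (Decidable (_ ∧ _ ∧ _))

/-- Abstract solution space. -/
def SS (P : Submodule (ZMod 2) E) (xu xv xw s t : E →ₗ[ZMod 2] ZMod 2) (p q r ε : ZMod 2) :
    Submodule (ZMod 2) E where
  carrier := {x | x ∈ P ∧ Eqs p q r ε (xu x) (xv x) (xw x) (s x) (t x)}
  zero_mem' := by simp [Eqs]
  add_mem' := by
    rintro x y ⟨hx, h1, h2, h3⟩ ⟨hy, k1, k2, k3⟩
    refine ⟨P.add_mem hx hy, ?_, ?_, ?_⟩ <;> simp only [map_add]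
    · linear_combination h1 + k1
    · linear_combination h2 + k2
    · linear_combination h3 + k3
  smul_mem' := by
    rintro c x ⟨hx, h1, h2, h3⟩
    refine ⟨P.smul_mem c hx, ?_, ?_, ?_⟩ <;> simp only [map_smul, smul_eq_mul]
    · linear_combination c * h1
    · linear_combination c * h2
    · linear_combination c * h3

variable [FiniteDimensional (ZMod 2) E]

theorem SS_le (P : Submodule (ZMod 2) E) (xu xv xw s t : E →ₗ[ZMod 2] ZMod 2) (e : E)
    (he : e ∈ P) (hu : xu e = 1) (hv : xv e = 1) (hw : xw e = 1) (hs : s e = 0) (ht : t e = 0)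
    (c1 c2 c3 p q r ε p' q' r' ε' : ZMod 2)
    (h : ∀ a b c s t, Eqs p q r ε a b c s t →
      Eqs p' q' r' ε' (a + (c1 * a + c2 * b + c3 * c)) (b + (c1 * a + c2 * b + c3 * c))
        (c + (c1 * a + c2 * b + c3 * c)) s t)
    (hinj : ∀ l, Eqs p q r ε l l l 0 0 → l + (c1 * l + c2 * l + c3 * l) = 0 → l = 0) :
    Module.finrank (ZMod 2) (SS P xu xv xw s t p q r ε) ≤
      Module.finrank (ZMod 2) (SS P xu xv xw s t p' q' r' ε') := by
  let lam : E →ₗ[ZMod 2] ZMod 2 := c1 • xu + c2 • xv + c3 • xw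
  let f : E →ₗ[ZMod 2] E := LinearMap.id + lam.smulRight e
  have hl : ∀ x, lam x = c1 * xu x + c2 * xv x + c3 * xw x := fun x => by simp [lam]
  have hf : ∀ x, f x = x + (c1 * xu x + c2 * xv x + c3 * xw x) • e := fun x => by
    simp [f, hl]
  have hmap : ∀ x ∈ SS P xu xv xw s t p q r ε, f x ∈ SS P xu xv xw s t p' q' r' ε' := by
    rintro x ⟨hx, hE⟩
    refine ⟨?_, ?_⟩
    · rw [hf]; exact P.add_mem hx (P.smul_mem _ he)
    · have := h _ _ _ _ _ hE
      rw [hf]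
      simpa [hu, hv, hw, hs, ht] using this
  apply LinearMap.finrank_le_finrank_of_injective (f := f.restrict hmap)
  rw [← LinearMap.ker_eq_bot, LinearMap.ker_eq_bot']
  rintro ⟨x, hx, hE⟩ h0
  have h0' : f x = 0 := congrArg Subtype.val h0
  rw [hf] at h0'
  set l := c1 * xu x + c2 * xv x + c3 * xw x with hldef
  have tw : ∀ a b : ZMod 2, a + b = 0 → a = b := by decide
  have e1 : xu x = l := tw _ _ (by simpa [hu] using congrArg xu h0')
  have e2 : xv x = l := tw _ _ (by simpa [hv] using congrArg xv h0')
  have e3 : xw x = l := tw _ _ (by simpa [hw] using congrArg xw h0')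
  have e4 : s x = 0 := by simpa [hs] using congrArg s h0'
  have e5 : t x = 0 := by simpa [ht] using congrArg t h0'
  rw [e1, e2, e3] at hldef
  rw [e1, e2, e3, e4, e5] at hE
  have : l = 0 := hinj l hE (by rw [← hldef]; exact CharTwo.add_self_eq_zero _)
  rw [this] at h0'
  apply Subtype.ext
  simpa using h0'

theorem SS_succ (P : Submodule (ZMod 2) E) (xu xv xw s t : E →ₗ[ZMod 2] ZMod 2) (e : E)
    (he : e ∈ P) (hu : xu e = 1) (hv : xv e = 1) (hw : xw e = 1) (hs : s e = 0) (ht : t e = 0)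
    (ε : ZMod 2) :
    Module.finrank (ZMod 2) (SS P xu xv xw s t 0 0 0 ε) =
      Module.finrank (ZMod 2) (SS P xu xv xw s t 1 0 0 ε) + 1 := by
  have heS : e ∈ SS P xu xv xw s t 0 0 0 ε := by
    refine ⟨he, ?_⟩
    rw [hu, hv, hw, hs, ht]; revert ε; decide
  have h1 : ∀ ε a b c s t : ZMod 2, Eqs 1 0 0 ε a b c s t → a = 0 := by decide
  have h2 : ∀ ε a b c s t : ZMod 2, Eqs 1 0 0 ε a b c s t → Eqs 0 0 0 ε a b c s t := by decide
  have h3 : ∀ ε b c s t : ZMod 2, Eqs 0 0 0 ε 0 b c s t → Eqs 1 0 0 ε 0 b c s t := by decide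
  have hsup : SS P xu xv xw s t 0 0 0 ε = SS P xu xv xw s t 1 0 0 ε ⊔ Submodule.span _ {e} := by
    apply le_antisymm
    · intro x hx
      have hy : x - xu x • e ∈ SS P xu xv xw s t 0 0 0 ε :=
        Submodule.sub_mem _ hx (Submodule.smul_mem _ _ heS)
      have hz : xu (x - xu x • e) = 0 := by simp [hu]
      have hy' : x - xu x • e ∈ SS P xu xv xw s t 1 0 0 ε := by
        refine ⟨hy.1, ?_⟩
        have := hy.2
        rw [hz] at this ⊢
        exact h3 _ _ _ _ _ this
      have := Submodule.add_mem_sup hy'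
        (Submodule.smul_mem _ (xu x) (Submodule.mem_span_singleton_self e))
      simpa using this
    · apply sup_le
      · rintro x ⟨hx, hE⟩
        exact ⟨hx, h2 _ _ _ _ _ _ hE⟩
      · rw [Submodule.span_singleton_le_iff_mem]; exact heS
  have hinf : SS P xu xv xw s t 1 0 0 ε ⊓ Submodule.span _ {e} = ⊥ := by
    rw [eq_bot_iff]
    rintro x ⟨hx, hxe⟩
    obtain ⟨c, rfl⟩ := Submodule.mem_span_singleton.1 hxe
    have := h1 _ _ _ _ _ _ hx.2
    have hc : c = 0 := by simpa [hu] using this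
    simp [hc]
  have hne : e ≠ 0 := by rintro rfl; simp at hu
  have := Submodule.finrank_sup_add_finrank_inf_eq (SS P xu xv xw s t 1 0 0 ε)
    (Submodule.span (ZMod 2) {e})
  rw [hinf, finrank_bot, finrank_span_singleton hne, ← hsup] at this
  simpa using this

theorem SS_all (P : Submodule (ZMod 2) E) (xu xv xw s t : E →ₗ[ZMod 2] ZMod 2) (e : E)
    (he : e ∈ P) (hu : xu e = 1) (hv : xv e = 1) (hw : xw e = 1) (hs : s e = 0) (ht : t e = 0)
    (N : ZMod 2 → ZMod 2 → ZMod 2 → ZMod 2 → ℕ)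
    (hN : ∀ p q r ε, N p q r ε = Module.finrank (ZMod 2) (SS P xu xv xw s t p q r ε)) :
    ∃ f0 f1 g1 g2 g3 : ℕ,
      (N 1 0 0 1 = f1 ∧ N 0 1 0 1 = f1 ∧ N 0 0 1 1 = f1 ∧ N 1 1 1 1 = f0 ∧ N 0 0 0 1 = f1 + 1 ∧
        N 1 1 0 1 = g1 ∧ N 1 0 1 1 = g2 ∧ N 0 1 1 1 = g3) ∧
      (N 1 0 0 0 = f0 ∧ N 0 1 0 0 = f0 ∧ N 0 0 1 0 = f0 ∧ N 1 1 1 0 = f1 ∧ N 0 0 0 0 = f0 + 1 ∧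
        N 1 1 0 0 = g1 ∧ N 1 0 1 0 = g2 ∧ N 0 1 1 0 = g3) := by
  have L := SS_le P xu xv xw s t e he hu hv hw hs ht
  simp only [← hN] at L
  have S := SS_succ P xu xv xw s t e he hu hv hw hs ht
  simp only [← hN] at S
  -- target `(p', q', r')` of odd sum uses `xw + p' (xu + xw) + q' (xv + xw)`
  have a100 : ∀ ε, N 1 0 0 ε = N 0 1 0 ε := by
    intro ε
    have : ε = 0 ∨ ε = 1 := by revert ε; decide
    apply le_antisymm
    · apply L 0 1 0 <;> rcases this with rfl | rfl <;> decide
    · apply L 1 0 0 <;> rcases this with rfl | rfl <;> decide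
  have a001 : ∀ ε, N 1 0 0 ε = N 0 0 1 ε := by
    intro ε
    have : ε = 0 ∨ ε = 1 := by revert ε; decide
    apply le_antisymm
    · apply L 0 0 1 <;> rcases this with rfl | rfl <;> decide
    · apply L 1 0 0 <;> rcases this with rfl | rfl <;> decide
  have b0 : N 1 0 0 0 = N 1 1 1 1 := by
    apply le_antisymm
    · apply L 1 1 1 <;> decide
    · apply L 1 0 0 <;> decide
  have b1 : N 1 0 0 1 = N 1 1 1 0 := by
    apply le_antisymm
    · apply L 1 1 1 <;> decide
    · apply L 1 0 0 <;> decide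
  have c1 : N 1 1 0 0 = N 1 1 0 1 := by
    apply le_antisymm <;> apply L 1 0 1 <;> decide
  have c2 : N 1 0 1 0 = N 1 0 1 1 := by
    apply le_antisymm <;> apply L 0 1 1 <;> decide
  have c3 : N 0 1 1 0 = N 0 1 1 1 := by
    apply le_antisymm <;> apply L 1 0 1 <;> decide
  refine ⟨N 1 0 0 0, N 1 0 0 1, N 1 1 0 0, N 1 0 1 0, N 0 1 1 0, ⟨rfl, (a100 1).symm, (a001 1).symm,
    b0.symm, S 1, c1.symm, c2.symm, c3.symm⟩, rfl, (a100 0).symm, (a001 0).symm,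
    b1.symm, S 0, rfl, rfl, rfl⟩

end Abstract

section Concrete

variable {V : Type} [Fintype V] [DecidableEq V]

/-- Kernel of `𝒜(G)_T`, extended by zero. -/
def sol (G : MarkedGraph V) (T : Finset V) : Submodule (ZMod 2) (V → ZMod 2) where
  carrier := {x | ∀ i, (i ∉ G.keep T → x i = 0) ∧
    (i ∈ G.keep T → ∑ j, (G.adj + delta T) i j * x j = 0)}
  zero_mem' := by simp
  add_mem' := by
    intro x y hx hy i
    refine ⟨fun h => by simp [(hx i).1 h, (hy i).1 h], fun h => ?_⟩
    have h1 := (hx i).2 h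
    have h2 := (hy i).2 h
    simp only [Pi.add_apply, mul_add, Finset.sum_add_distrib] at *
    rw [h1, h2, add_zero]
  smul_mem' := by
    intro c x hx i
    refine ⟨fun h => by simp [(hx i).1 h], fun h => ?_⟩
    have h1 := (hx i).2 h
    simp only [Pi.smul_apply, smul_eq_mul, mul_left_comm _ c, ← Finset.mul_sum]
    rw [h1, mul_zero]

theorem nullity_eq (G : MarkedGraph V) (T : Finset V) :
    nullity (G.subMat T) = Module.finrank (ZMod 2) (G.sol T) := by
  unfold nullity
  have key : ∀ x : V → ZMod 2, (∀ i, i ∉ G.keep T → x i = 0) → ∀ i,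
      ∑ j : G.keep T, (G.adj + delta T) i j.1 * x j.1 = ∑ j, (G.adj + delta T) i j * x j := by
    intro x hx i
    rw [Finset.sum_coe_sort (G.keep T) (fun j => (G.adj + delta T) i j * x j)]
    apply Finset.sum_subset (Finset.subset_univ _)
    intro j _ hj
    rw [hx j hj, mul_zero]
  let res : (V → ZMod 2) →ₗ[ZMod 2] (G.keep T → ZMod 2) := LinearMap.funLeft _ _ Subtype.val
  symm
  have hmap : ∀ x ∈ G.sol T, res x ∈ LinearMap.ker (G.subMat T).mulVecLin := by
    intro x hx
    rw [LinearMap.mem_ker]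
    ext i
    have := (hx i.1).2 i.2
    rw [← key x (fun i => (hx i).1)] at this
    simpa [Matrix.mulVec, dotProduct, subMat, res, LinearMap.funLeft_apply] using this
  apply LinearEquiv.finrank_eq
  refine LinearEquiv.ofBijective (res.restrict hmap) ⟨?_, ?_⟩
  · rw [← LinearMap.ker_eq_bot, LinearMap.ker_eq_bot']
    rintro ⟨x, hx⟩ h0
    have h0' : res x = 0 := congrArg Subtype.val h0
    apply Subtype.ext
    funext i
    by_cases hi : i ∈ G.keep T
    · exact congrFun h0' ⟨i, hi⟩
    · exact (hx i).1 hi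
  · rintro ⟨y, hy⟩
    let x : V → ZMod 2 := fun i => if h : i ∈ G.keep T then y ⟨i, h⟩ else 0
    have hx0 : ∀ i, i ∉ G.keep T → x i = 0 := fun i hi => by simp [x, hi]
    have hxy : ∀ j : G.keep T, x j.1 = y j := fun j => by simp [x]
    refine ⟨⟨x, fun i => ⟨hx0 i, fun hi => ?_⟩⟩, ?_⟩
    · rw [← key x hx0]
      simp only [hxy]
      exact congrFun (LinearMap.mem_ker.1 hy) ⟨i, hi⟩
    · apply Subtype.ext
      funext j
      exact hxy j

/-- The equations away from `u, v, w`. -/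
def PP (G : MarkedGraph V) (T : Finset V) (u v w : V) : Submodule (ZMod 2) (V → ZMod 2) where
  carrier := {x | ∀ i, i ≠ u → i ≠ v → i ≠ w → (i ∉ G.keep T → x i = 0) ∧
    (i ∈ G.keep T → ∑ j, (G.adj + delta T) i j * x j = 0)}
  zero_mem' := by simp
  add_mem' := by
    intro x y hx hy i a b c
    refine ⟨fun h => by simp [(hx i a b c).1 h, (hy i a b c).1 h], fun h => ?_⟩
    have h1 := (hx i a b c).2 h
    have h2 := (hy i a b c).2 h
    simp only [Pi.add_apply, mul_add, Finset.sum_add_distrib] at *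
    rw [h1, h2, add_zero]
  smul_mem' := by
    intro c x hx i a b d
    refine ⟨fun h => by simp [(hx i a b d).1 h], fun h => ?_⟩
    have h1 := (hx i a b d).2 h
    simp only [Pi.smul_apply, smul_eq_mul, mul_left_comm _ c, ← Finset.mul_sum]
    rw [h1, mul_zero]

/-- All vertices but `u, v, w`. -/
def rest (u v w : V) : Finset V := ((Finset.univ.erase u).erase v).erase w

theorem sum_split (u v w : V) (huv : u ≠ v) (huw : u ≠ w) (hvw : v ≠ w) (f : V → ZMod 2) :
    ∑ j, f j = f u + f v + f w + ∑ j ∈ rest u v w, f j := by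
  unfold rest
  rw [← Finset.add_sum_erase _ _ (Finset.mem_univ u), ← Finset.add_sum_erase _ _ (a := v),
    ← Finset.add_sum_erase _ _ (a := w)]
  · ring
  · simp [hvw.symm, huw.symm]
  · simp [huv.symm]

/-- The functional given by row `y`, away from `u, v, w`. -/
def rowL (G : MarkedGraph V) (u v w y : V) : (V → ZMod 2) →ₗ[ZMod 2] ZMod 2 :=
  ∑ j ∈ rest u v w, G.adj y j • LinearMap.proj j

theorem rowL_apply (G : MarkedGraph V) (u v w y : V) (x : V → ZMod 2) :
    G.rowL u v w y x = ∑ j ∈ rest u v w, G.adj y j * x j := by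
  simp [rowL]

theorem sol_eq (G H : MarkedGraph V) (u v w : V)
    (huv : u ≠ v) (huw : u ≠ w) (hvw : v ≠ w)
    (hmu : G.marked u = false) (hmv : G.marked v = false) (hmw : G.marked w = false)
    (hm : H.marked = G.marked)
    (hrow : ∀ i j, i ≠ u → i ≠ v → i ≠ w → H.adj i j = G.adj i j)
    (hcol : ∀ i j, j ≠ u → j ≠ v → j ≠ w → H.adj i j = G.adj i j)
    (hsum : ∀ j, j ≠ u → j ≠ v → j ≠ w → G.adj w j = G.adj u j + G.adj v j)
    (ε p q r : ZMod 2)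
    (h1 : H.adj u v = ε) (h2 : H.adj v u = ε) (h3 : H.adj u w = ε) (h4 : H.adj w u = ε)
    (h5 : H.adj v w = ε) (h6 : H.adj w v = ε)
    (T T' : Finset V) (hT : ∀ i, i ≠ u → i ≠ v → i ≠ w → (i ∈ T ↔ i ∈ T'))
    (hp : (H.adj + delta T) u u = p) (hq : (H.adj + delta T) v v = q)
    (hr : (H.adj + delta T) w w = r) :
    H.sol T = SS (G.PP T' u v w) (LinearMap.proj u) (LinearMap.proj v) (LinearMap.proj w)
      (G.rowL u v w u) (G.rowL u v w v) p q r ε := by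
  have hd : ∀ i j, i ≠ u → i ≠ v → i ≠ w → (H.adj + delta T) i j = (G.adj + delta T') i j := by
    intro i j a b c
    simp [hrow i j a b c, delta, Matrix.diagonal_apply, hT i a b c]
  have hk : ∀ i, i ≠ u → i ≠ v → i ≠ w → (i ∈ H.keep T ↔ i ∈ G.keep T') := by
    intro i a b c
    simp only [keep, Finset.mem_filter, hd i i a b c, hm]
  have ku : u ∈ H.keep T := by simp [keep, hm, hmu]
  have kv : v ∈ H.keep T := by simp [keep, hm, hmv]
  have kw : w ∈ H.keep T := by simp [keep, hm, hmw]
  have hne : ∀ i j, i ≠ j → (H.adj + delta T) i j = H.adj i j := by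
    intro i j h
    simp [delta, Matrix.diagonal_apply, h]
  have hmem : ∀ j ∈ rest u v w, j ≠ u ∧ j ≠ v ∧ j ≠ w := by
    intro j hj
    simp only [rest, Finset.mem_erase] at hj
    tauto
  have hrs : ∀ y, (y = u ∨ y = v ∨ y = w) → ∀ x : V → ZMod 2,
      ∑ j ∈ rest u v w, (H.adj + delta T) y j * x j = G.rowL u v w y x := by
    intro y hy x
    rw [rowL_apply]
    apply Finset.sum_congr rfl
    intro j hj
    obtain ⟨a, b, c⟩ := hmem j hj
    rw [hne, hcol _ _ a b c]
    rintro rfl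
    tauto
  have hrw : ∀ x, G.rowL u v w w x = G.rowL u v w u x + G.rowL u v w v x := by
    intro x
    simp only [rowL_apply, ← Finset.sum_add_distrib]
    apply Finset.sum_congr rfl
    intro j hj
    obtain ⟨a, b, c⟩ := hmem j hj
    rw [hsum j a b c]; ring
  have eu : ∀ x : V → ZMod 2, ∑ j, (H.adj + delta T) u j * x j =
      p * x u + ε * (x v + x w) + G.rowL u v w u x := by
    intro x
    rw [sum_split u v w huv huw hvw, hrs u (by tauto), hp, hne u v huv, hne u w huw, h1, h3]; ring
  have ev : ∀ x : V → ZMod 2, ∑ j, (H.adj + delta T) v j * x j =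
      q * x v + ε * (x u + x w) + G.rowL u v w v x := by
    intro x
    rw [sum_split u v w huv huw hvw, hrs v (by tauto), hq, hne v u huv.symm, hne v w hvw, h2, h5]
    ring
  have ew : ∀ x : V → ZMod 2, ∑ j, (H.adj + delta T) w j * x j =
      r * x w + ε * (x u + x v) + (G.rowL u v w u x + G.rowL u v w v x) := by
    intro x
    rw [sum_split u v w huv huw hvw, hrs w (by tauto), hr, hne w u huw.symm, hne w v hvw.symm,
      h4, h6, hrw]
    ring
  ext x
  constructor
  · intro hx
    refine ⟨fun i a b c => ?_, ?_, ?_, ?_⟩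
    · have := hx i
      rw [hk i a b c] at this
      simpa only [hd i _ a b c] using this
    · have := (hx u).2 ku
      rwa [eu] at this
    · have := (hx v).2 kv
      rwa [ev] at this
    · have := (hx w).2 kw
      rwa [ew] at this
  · rintro ⟨hx, k1, k2, k3⟩ i
    by_cases a : i = u
    · subst a
      exact ⟨fun h => absurd ku h, fun _ => by rw [eu]; exact k1⟩
    by_cases b : i = v
    · subst b
      exact ⟨fun h => absurd kv h, fun _ => by rw [ev]; exact k2⟩
    by_cases c : i = w
    · subst c
      exact ⟨fun h => absurd kw h, fun _ => by rw [ew]; exact k3⟩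
    have := hx i a b c
    rw [← hk i a b c] at this
    simpa only [hd i _ a b c] using this

theorem sum_finset_split {R : Type*} [CommRing R] (u v w : V)
    (huv : u ≠ v) (huw : u ≠ w) (hvw : v ≠ w) (f : Finset V → R) :
    ∑ T, f T = ∑ T ∈ (rest u v w).powerset,
      (f T + f (insert w T) + f (insert v T) + f (insert v (insert w T)) +
       f (insert u T) + f (insert u (insert w T)) + f (insert u (insert v T)) +
       f (insert u (insert v (insert w T)))) := by
  have e : (Finset.univ : Finset (Finset V)) =
      (insert u (insert v (insert w (rest u v w)))).powerset := by
    ext T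
    simp only [Finset.mem_univ, Finset.mem_powerset, true_iff]
    intro x _
    simp only [rest, Finset.mem_insert, Finset.mem_erase, Finset.mem_univ]
    tauto
  have H1 := fun f : Finset V → R => Finset.sum_powerset_insert
    (s := insert v (insert w (rest u v w))) (a := u) (by simp [rest, huv, huw]) f
  have H2 := fun f : Finset V → R => Finset.sum_powerset_insert
    (s := insert w (rest u v w)) (a := v) (by simp [rest, hvw]) f
  have H3 := fun f : Finset V → R => Finset.sum_powerset_insert
    (s := rest u v w) (a := w) (by simp [rest]) f
  rw [e]
  simp only [H1, H2, H3]
  simp only [← Finset.sum_add_distrib]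
  apply Finset.sum_congr rfl
  intro T _
  ring

end Concrete

end MarkedGraph

/-- If `u`, `v`, `w` are pairwise adjacent unmarked vertices, `u`
looped, `v` and `w` unlooped, and every vertex outside `{u,v,w}` is adjacent to 0 or
precisely 2 of `u,v,w`, then removing the three edges `{u,v}`, `{u,w}`, `{v,w}`
leaves the reduced bracket unchanged. -/
theorem reducedBracket_omega3a {V : Type} [Fintype V] [DecidableEq V]
    (G : MarkedGraph V) (hsym : G.adj.IsSymm) (u v w : V)
    (huv : u ≠ v) (huw : u ≠ w) (hvw : v ≠ w)
    (hmu : G.marked u = false) (hmv : G.marked v = false) (hmw : G.marked w = false)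
    (hauv : G.adj u v = 1) (hauw : G.adj u w = 1) (havw : G.adj v w = 1)
    (hu : G.adj u u = 1) (hv : G.adj v v = 0) (hw : G.adj w w = 0)
    (hout : ∀ x, x ≠ u → x ≠ v → x ≠ w →
      G.countAdj x {u, v, w} = 0 ∨ G.countAdj x {u, v, w} = 2) :
    G.reducedBracket = (G.removeEdges3 u v w).reducedBracket := by
  classical
  have hs : ∀ x y, G.adj x y = G.adj y x := fun x y => hsym.apply y x
  have hsum : ∀ j, j ≠ u → j ≠ v → j ≠ w → G.adj w j = G.adj u j + G.adj v j := by
    intro j a b c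
    have h := hout j a b c
    rw [hs w j, hs u j, hs v j]
    unfold MarkedGraph.countAdj at h
    have z : ∀ y : ZMod 2, y = 0 ∨ y = 1 := by decide
    have n01 : (0 : ZMod 2) ≠ 1 := by decide
    have n11 : (0 : ZMod 2) = 1 + 1 := by decide
    rcases z (G.adj j u) with h1 | h1 <;> rcases z (G.adj j v) with h2 | h2 <;>
      rcases z (G.adj j w) with h3 | h3 <;>
      simp [Finset.filter_insert, Finset.filter_singleton, h1, h2, h3, huv, huw, hvw] at h ⊢
    exact n11
  set H := G.removeEdges3 u v w with hH
  have hHrow : ∀ i j, i ≠ u → i ≠ v → i ≠ w → H.adj i j = G.adj i j := by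
    intro i j a b c
    simp [hH, MarkedGraph.removeEdges3, a, b, c]
  have hHcol : ∀ i j, j ≠ u → j ≠ v → j ≠ w → H.adj i j = G.adj i j := by
    intro i j a b c
    simp [hH, MarkedGraph.removeEdges3, a, b, c]
  have hHu : H.adj u u = 1 := by simp [hH, MarkedGraph.removeEdges3, huv, huw, hu]
  have hHv : H.adj v v = 0 := by simp [hH, MarkedGraph.removeEdges3, hv]
  have hHw : H.adj w w = 0 := by simp [hH, MarkedGraph.removeEdges3, hw]
  have hF : H.freeLoops = G.freeLoops := rfl
  unfold MarkedGraph.reducedBracket MarkedGraph.bracket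
  rw [hF]
  simp only [map_mul, map_sum, map_pow, MvPolynomial.aeval_X]
  congr 1
  set A : LaurentPolynomial ℤ := LaurentPolynomial.T 1 with hA
  set B : LaurentPolynomial ℤ := LaurentPolynomial.T (-1) with hB
  set d : LaurentPolynomial ℤ := -LaurentPolynomial.T 2 - LaurentPolynomial.T (-2) with hd
  have hAB : A * B = 1 := by
    rw [hA, hB, ← LaurentPolynomial.T_add]; simp
  have hd' : d = - A ^ 2 - B ^ 2 := by
    rw [hA, hB, hd, LaurentPolynomial.T_pow, LaurentPolynomial.T_pow]; norm_num
  have m0 : (![A, B, d] : Fin 3 → LaurentPolynomial ℤ) 0 = A := rfl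
  have m1 : (![A, B, d] : Fin 3 → LaurentPolynomial ℤ) 1 = B := rfl
  have m2 : (![A, B, d] : Fin 3 → LaurentPolynomial ℤ) 2 = d := rfl
  rw [m0, m1, m2]
  rw [MarkedGraph.sum_finset_split u v w huv huw hvw,
    MarkedGraph.sum_finset_split u v w huv huw hvw]
  apply Finset.sum_congr rfl
  intro T hT
  rw [Finset.mem_powerset] at hT
  have hTu : u ∉ T := fun h => by have := hT h; simp [MarkedGraph.rest] at this
  have hTv : v ∉ T := fun h => by have := hT h; simp [MarkedGraph.rest] at this
  have hTw : w ∉ T := fun h => by have := hT h; simp [MarkedGraph.rest] at this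
  obtain ⟨m, hm⟩ : ∃ m, Fintype.card V = T.card + 3 + m := by
    have h := Finset.card_le_univ (insert u (insert v (insert w T)))
    rw [Finset.card_insert_of_notMem (by simp [*]), Finset.card_insert_of_notMem (by simp [*]),
      Finset.card_insert_of_notMem hTw] at h
    exact ⟨Fintype.card V - (T.card + 3), by omega⟩
  let N : ZMod 2 → ZMod 2 → ZMod 2 → ZMod 2 → ℕ := fun p q r ε =>
    Module.finrank (ZMod 2) (MarkedGraph.SS (G.PP T u v w) (LinearMap.proj u) (LinearMap.proj v)
      (LinearMap.proj w) (G.rowL u v w u) (G.rowL u v w v) p q r ε)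
  have hG : ∀ T' p q r, (∀ i, i ≠ u → i ≠ v → i ≠ w → (i ∈ T' ↔ i ∈ T)) →
      (1 + if u ∈ T' then 1 else 0 : ZMod 2) = p → (if v ∈ T' then 1 else 0 : ZMod 2) = q →
      (if w ∈ T' then 1 else 0 : ZMod 2) = r → MarkedGraph.nullity (G.subMat T') = N p q r 1 := by
    intro T' p q r h1 h2 h3 h4
    rw [MarkedGraph.nullity_eq, MarkedGraph.sol_eq G G u v w huv huw hvw hmu hmv hmw rfl
      (fun _ _ _ _ _ => rfl) (fun _ _ _ _ _ => rfl) hsum 1 p q r hauv (by rw [hs, hauv])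
      hauw (by rw [hs, hauw]) havw (by rw [hs, havw]) T' T h1
      (by simpa [MarkedGraph.delta, hu] using h2) (by simpa [MarkedGraph.delta, hv] using h3)
      (by simpa [MarkedGraph.delta, hw] using h4)]
  have hH' : ∀ T' p q r, (∀ i, i ≠ u → i ≠ v → i ≠ w → (i ∈ T' ↔ i ∈ T)) →
      (1 + if u ∈ T' then 1 else 0 : ZMod 2) = p → (if v ∈ T' then 1 else 0 : ZMod 2) = q →
      (if w ∈ T' then 1 else 0 : ZMod 2) = r → MarkedGraph.nullity (H.subMat T') = N p q r 0 := by
    intro T' p q r h1 h2 h3 h4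
    rw [MarkedGraph.nullity_eq, MarkedGraph.sol_eq G H u v w huv huw hvw hmu hmv hmw rfl
      hHrow hHcol hsum 0 p q r (by simp [hH, MarkedGraph.removeEdges3])
      (by simp [hH, MarkedGraph.removeEdges3]) (by simp [hH, MarkedGraph.removeEdges3])
      (by simp [hH, MarkedGraph.removeEdges3]) (by simp [hH, MarkedGraph.removeEdges3])
      (by simp [hH, MarkedGraph.removeEdges3]) T' T h1
      (by simpa [MarkedGraph.delta, hHu] using h2) (by simpa [MarkedGraph.delta, hHv] using h3)
      (by simpa [MarkedGraph.delta, hHw] using h4)]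
  have n11 : (1 + 1 : ZMod 2) = 0 := by decide
  let e : V → ZMod 2 := fun i => if i = u ∨ i = v ∨ i = w then 1 else 0
  have hrest : ∀ y, G.rowL u v w y e = 0 := by
    intro y
    rw [MarkedGraph.rowL_apply]
    apply Finset.sum_eq_zero
    intro j hj
    simp only [MarkedGraph.rest, Finset.mem_erase] at hj
    simp [e, hj]
  have he : e ∈ G.PP T u v w := by
    intro i a b c
    refine ⟨fun _ => by simp [e, a, b, c], fun _ => ?_⟩
    rw [MarkedGraph.sum_split u v w huv huw hvw]
    rw [Finset.sum_eq_zero]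
    · have := hsum i a b c
      rw [hs w i, hs u i, hs v i] at this
      simp [e, MarkedGraph.delta, a, b, c, this]
      exact CharTwo.add_self_eq_zero _
    · intro j hj
      simp only [MarkedGraph.rest, Finset.mem_erase] at hj
      simp [e, hj]
  obtain ⟨f0, f1, g1, g2, g3, ⟨a1, a2, a3, a4, a5, a6, a7, a8⟩, b1, b2, b3, b4, b5, b6, b7, b8⟩ :=
    MarkedGraph.SS_all (G.PP T u v w) (LinearMap.proj u) (LinearMap.proj v)
      (LinearMap.proj w) (G.rowL u v w u) (G.rowL u v w v) e he (by simp [e]) (by simp [e])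
      (by simp [e]) (hrest u) (hrest v) N (fun _ _ _ _ => rfl)
  rw [hG T 1 0 0, hG (insert w T) 1 0 1, hG (insert v T) 1 1 0, hG (insert v (insert w T)) 1 1 1,
    hG (insert u T) 0 0 0, hG (insert u (insert w T)) 0 0 1, hG (insert u (insert v T)) 0 1 0,
    hG (insert u (insert v (insert w T))) 0 1 1,
    hH' T 1 0 0, hH' (insert w T) 1 0 1, hH' (insert v T) 1 1 0, hH' (insert v (insert w T)) 1 1 1,
    hH' (insert u T) 0 0 0, hH' (insert u (insert w T)) 0 0 1, hH' (insert u (insert v T)) 0 1 0,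
    hH' (insert u (insert v (insert w T))) 0 1 1,
    a1, a2, a3, a4, a5, a6, a7, a8, b1, b2, b3, b4, b5, b6, b7, b8]
  · have k1 : (insert w T).card = T.card + 1 := Finset.card_insert_of_notMem hTw
    have k2 : (insert v T).card = T.card + 1 := Finset.card_insert_of_notMem hTv
    have k3 : (insert u T).card = T.card + 1 := Finset.card_insert_of_notMem hTu
    have k4 : (insert v (insert w T)).card = T.card + 2 := by
      rw [Finset.card_insert_of_notMem (by simp [*]), k1]
    have k5 : (insert u (insert w T)).card = T.card + 2 := by
      rw [Finset.card_insert_of_notMem (by simp [*]), k1]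
    have k6 : (insert u (insert v T)).card = T.card + 2 := by
      rw [Finset.card_insert_of_notMem (by simp [*]), k2]
    have k7 : (insert u (insert v (insert w T))).card = T.card + 3 := by
      rw [Finset.card_insert_of_notMem (by simp [*]), k4]
    rw [k1, k2, k3, k4, k5, k6, k7, hm]
    have s0 : T.card + 3 + m - T.card = m + 3 := by omega
    have s1 : T.card + 3 + m - (T.card + 1) = m + 2 := by omega
    have s2 : T.card + 3 + m - (T.card + 2) = m + 1 := by omega
    have s3 : T.card + 3 + m - (T.card + 3) = m := by omega
    rw [s0, s1, s2, s3]
    have key : A ^ 3 + A * B ^ 2 + A ^ 2 * B * d = 0 := by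
      rw [hd']
      linear_combination (-A ^ 3 - A * B ^ 2) * hAB
    linear_combination (A ^ m * B ^ T.card * (d ^ f1 - d ^ f0)) * key
  all_goals first
    | (intro i a b c; simp [a, b, c]; done)
    | (simp [huv, huw, hvw, huv.symm, huw.symm, hvw.symm, hTu, hTv, hTw, n11]; done)
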